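/- Let G be a finite tree with vertex set V and graph distance d, let P₁, …, P_k (k ≥ 1) be pairwise disjoint pairs P_i = {v_i, u_i} of distinct vertices of G, let W = P₁ ∪ ⋯ ∪ P_k, and let D = max_{u,w ∈ W} d(u, w). Suppose that either (1) there exist three pairwise distinct vertices x, y, z ∈ W with d(x, y) = d(y, z) = d(x, z) = D, or (2) there exist an index i ∈ {1, …, k} and a vertex z ∈ W with d(v_i, z) = d(u_i, z) = D. Then min over all assignments σ of max(diam(Red(σ)), diam(Blue(σ))) equals D. -/

import Mathlib

/-- The diameter of a finite vertex set `S` in a graph `G`: `max_{x,y ∈ S} d(x, y)`. -/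
noncomputable def finsetDiam {V : Type*} (G : SimpleGraph V) (S : Finset V) : ℕ :=
  S.sup fun x => S.sup fun y => G.dist x y

/-- The set of red vertices under the assignment `σ`: from each pair `{v i, u i}`, the vertex
`v i` is red if `σ i = true`, and otherwise `u i` is red. -/
def redSet {V : Type*} [DecidableEq V] {k : ℕ} (v u : Fin k → V)
    (σ : Fin k → Bool) : Finset V :=
  Finset.univ.image fun i => if σ i then v i else u i

/-- The set of blue vertices under the assignment `σ` (the other vertex of each pair). -/
def blueSet {V : Type*} [DecidableEq V] {k : ℕ} (v u : Fin k → V)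
    (σ : Fin k → Bool) : Finset V :=
  Finset.univ.image fun i => if σ i then u i else v i

theorem dist_le_finsetDiam {V : Type*} (G : SimpleGraph V) {S : Finset V} {x y : V}
    (hx : x ∈ S) (hy : y ∈ S) : G.dist x y ≤ finsetDiam G S :=
  (Finset.le_sup (f := fun y => G.dist x y) hy).trans
    (Finset.le_sup (f := fun x => S.sup fun y => G.dist x y) hx)

theorem finsetDiam_mono {V : Type*} (G : SimpleGraph V) {S T : Finset V} (h : S ⊆ T) :
    finsetDiam G S ≤ finsetDiam G T :=
  Finset.sup_le fun _ hx => Finset.sup_le fun _ hy => dist_le_finsetDiam G (h hx) (h hy)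

theorem redSet_union_blueSet {V : Type*} [DecidableEq V] {k : ℕ} (v u : Fin k → V)
    (σ : Fin k → Bool) :
    redSet v u σ ∪ blueSet v u σ = Finset.univ.image v ∪ Finset.univ.image u := by
  ext x
  simp only [redSet, blueSet, Finset.mem_union, Finset.mem_image, Finset.mem_univ, true_and,
    ← exists_or]
  refine exists_congr fun i => ?_
  cases σ i <;> simp [or_comm]

theorem mem_redSet_and_mem_blueSet_or {V : Type*} [DecidableEq V] {k : ℕ} (v u : Fin k → V)
    (σ : Fin k → Bool) (i : Fin k) :
    (v i ∈ redSet v u σ ∧ u i ∈ blueSet v u σ) ∨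
      (u i ∈ redSet v u σ ∧ v i ∈ blueSet v u σ) := by
  simp only [redSet, blueSet, Finset.mem_image, Finset.mem_univ, true_and]
  cases h : σ i
  · exact Or.inr ⟨⟨i, by simp [h]⟩, ⟨i, by simp [h]⟩⟩
  · exact Or.inl ⟨⟨i, by simp [h]⟩, ⟨i, by simp [h]⟩⟩

/-- The degenerate-case claim of the paper's unweighted tree algorithm: if `W` (the set of
all paired vertices, with diameter `D`) contains three pairwise distinct vertices mutually at
distance `D`, or contains a pair `P i` both of whose vertices are at distance `D` from a
common vertex `z ∈ W`, then the minimum over all assignments of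
`max(diam(Red(σ)), diam(Blue(σ)))` equals `D`. -/
theorem stmt_9 {V : Type*} [Fintype V] [DecidableEq V] (G : SimpleGraph V)
    (hT : G.IsTree) (k : ℕ) (hk : 1 ≤ k) (v u : Fin k → V)
    (hvu : ∀ i, v i ≠ u i)
    (hdisj : ∀ i j : Fin k, i ≠ j → ({v i, u i} : Set V) ∩ {v j, u j} = ∅)
    (W : Finset V) (hW : W = Finset.univ.image v ∪ Finset.univ.image u)
    (D : ℕ) (hD : D = W.sup fun x => W.sup fun y => G.dist x y)
    (hcond :
      (∃ x ∈ W, ∃ y ∈ W, ∃ z ∈ W, x ≠ y ∧ y ≠ z ∧ x ≠ z ∧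
        G.dist x y = D ∧ G.dist y z = D ∧ G.dist x z = D) ∨
      (∃ i : Fin k, ∃ z ∈ W, G.dist (v i) z = D ∧ G.dist (u i) z = D)) :
    sInf { n : ℕ | ∃ σ : Fin k → Bool,
        n = max (finsetDiam G (redSet v u σ)) (finsetDiam G (blueSet v u σ)) } = D := by
  have key : ∀ σ : Fin k → Bool,
      max (finsetDiam G (redSet v u σ)) (finsetDiam G (blueSet v u σ)) = D := by
    intro σ
    have hunion : redSet v u σ ∪ blueSet v u σ = W := (redSet_union_blueSet v u σ).trans hW.symm
    have hDW : D = finsetDiam G W := hD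
    refine le_antisymm (max_le ?_ ?_) ?_
    · exact hDW ▸ finsetDiam_mono G (hunion ▸ Finset.subset_union_left)
    · exact hDW ▸ finsetDiam_mono G (hunion ▸ Finset.subset_union_right)
    have red : ∀ {a b}, a ∈ redSet v u σ → b ∈ redSet v u σ → G.dist a b = D →
        D ≤ max (finsetDiam G (redSet v u σ)) (finsetDiam G (blueSet v u σ)) :=
      fun ha hb h => h ▸ (dist_le_finsetDiam G ha hb).trans (le_max_left _ _)
    have blue : ∀ {a b}, a ∈ blueSet v u σ → b ∈ blueSet v u σ → G.dist a b = D →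
        D ≤ max (finsetDiam G (redSet v u σ)) (finsetDiam G (blueSet v u σ)) :=
      fun ha hb h => h ▸ (dist_le_finsetDiam G ha hb).trans (le_max_right _ _)
    have hcol : ∀ {a}, a ∈ W → a ∈ redSet v u σ ∨ a ∈ blueSet v u σ :=
      fun ha => Finset.mem_union.1 (hunion ▸ ha)
    rcases hcond with ⟨x, hx, y, hy, z, hz, -, -, -, hxy, hyz, hxz⟩ | ⟨i, z, hz, hvz, huz⟩
    · rcases hcol hx with hx | hx <;> rcases hcol hy with hy | hy <;>
        rcases hcol hz with hz | hz <;>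
        first
        | exact red hx hy hxy
        | exact red hy hz hyz
        | exact red hx hz hxz
        | exact blue hx hy hxy
        | exact blue hy hz hyz
        | exact blue hx hz hxz
    · rcases mem_redSet_and_mem_blueSet_or v u σ i with ⟨hr, hb⟩ | ⟨hr, hb⟩ <;>
        rcases hcol hz with hz | hz
      · exact red hr hz hvz
      · exact blue hb hz huz
      · exact red hr hz huz
      · exact blue hb hz hvz
  simp [key]
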